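/- Let n ≥ 2 and p ∈ (1,∞). There exists a constant C_ddd depending only on n such that the following holds for every ε ∈ (0,1/p) and every integer k. Let 𝒦 = K₁ × K₂ where K₁, K₂ are axis-parallel dyadic cubes of side length 2^{−k}, and let 𝒦̃ = K̃₁ × K̃₂ be its predecessor, i.e. K̃₁ ⊃ K₁ and K̃₂ ⊃ K₂ are axis-parallel cubes of side length 2^{−k+1}. If dist(K̃₁, K̃₂) ≥ 2^{−k}, then ν(𝒦̃) ≤ C_ddd · ν(𝒦). -/

import Mathlib

open MeasureTheory Metric Set
open scoped ENNReal

noncomputable section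

/-- The dual-pair measure `ν` on `ℝⁿ × ℝⁿ`, with density `|x−y|^{−(n−εp)}`. -/
def nu (n : ℕ) (p ε : ℝ) :
    Measure (EuclideanSpace ℝ (Fin n) × EuclideanSpace ℝ (Fin n)) :=
  volume.withDensity fun z => ENNReal.ofReal (‖z.1 - z.2‖ ^ (ε * p - n))

/-- The half-open axis-parallel cube in `ℝⁿ` with corner `c` and side length `ℓ`. -/
def cube (n : ℕ) (c : EuclideanSpace ℝ (Fin n)) (ℓ : ℝ) : Set (EuclideanSpace ℝ (Fin n)) :=
  {y | ∀ i, c i ≤ y i ∧ y i < c i + ℓ}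

/-- Euclidean distance between two subsets of `ℝⁿ`. -/
def setDistE {n : ℕ} (A B : Set (EuclideanSpace ℝ (Fin n))) : ℝ :=
  sInf (Set.image2 dist A B)

lemma cube_eq_pre (n : ℕ) (c : EuclideanSpace ℝ (Fin n)) (l : ℝ) :
    cube n c l = (WithLp.ofLp) ⁻¹' (Set.pi univ fun i => Ico (c i) (c i + l)) := by
  ext y
  simp [cube]

lemma measurableSet_cube (n : ℕ) (c : EuclideanSpace ℝ (Fin n)) (l : ℝ) :
    MeasurableSet (cube n c l) := by
  rw [cube_eq_pre]
  exact (PiLp.volume_preserving_ofLp (Fin n)).measurable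
    (MeasurableSet.univ_pi fun i => measurableSet_Ico)

lemma volume_cube (n : ℕ) (c : EuclideanSpace ℝ (Fin n)) (l : ℝ) :
    volume (cube n c l) = ENNReal.ofReal l ^ n := by
  rw [cube_eq_pre, (PiLp.volume_preserving_ofLp (Fin n)).measure_preimage
    (MeasurableSet.univ_pi fun i => measurableSet_Ico).nullMeasurableSet, Real.volume_pi_Ico]
  simp

lemma norm_sub_le_cube (n : ℕ) (c x y : EuclideanSpace ℝ (Fin n)) (l : ℝ) (hl : 0 < l)
    (hx : x ∈ cube n c l) (hy : y ∈ cube n c l) : ‖x - y‖ ≤ n * l := by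
  rw [EuclideanSpace.norm_eq]
  apply Real.sqrt_le_iff.2 ⟨by positivity, ?_⟩
  have h1 : ∑ i, ‖(x - y) i‖ ^ 2 ≤ ∑ _i : Fin n, l ^ 2 := by
    apply Finset.sum_le_sum
    intro i _
    have := hx i
    have := hy i
    gcongr
    rw [Real.norm_eq_abs, abs_le]
    simp only [PiLp.sub_apply]
    constructor <;> linarith
  refine h1.trans ?_
  simp only [Finset.sum_const, Finset.card_univ, Fintype.card_fin, nsmul_eq_mul, mul_pow]
  gcongr
  exact_mod_cast Nat.le_self_pow two_ne_zero n

lemma density_le (n : ℕ) (s l : ℝ) (hl : 0 < l) (hs : s ≤ 0) (hs' : -n ≤ s)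
    (D U : ℝ) (hD : l ≤ D) (hU : l ≤ U) (hUD : U ≤ D + 4 * n * l) :
    D ^ s ≤ (1 + 4 * n : ℝ) ^ n * U ^ s := by
  have hD0 : 0 < D := hl.trans_le hD
  have hU0 : 0 < U := hl.trans_le hU
  have hB : (1 : ℝ) ≤ 1 + 4 * n := by
    have : (0 : ℝ) ≤ n := by positivity
    linarith
  have hB0 : (0 : ℝ) < 1 + 4 * n := by linarith
  have h1 : U ≤ (1 + 4 * n) * D := by
    have : 4 * n * l ≤ 4 * n * D := by gcongr
    linarith
  have h2 : ((1 + 4 * n) * D) ^ s ≤ U ^ s := Real.rpow_le_rpow_of_nonpos hU0 h1 hs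
  rw [Real.mul_rpow hB0.le hD0.le] at h2
  have h3 : (1 + 4 * n : ℝ) ^ (-(n : ℝ)) ≤ (1 + 4 * n : ℝ) ^ s :=
    Real.rpow_le_rpow_of_exponent_le hB hs'
  rw [Real.rpow_neg hB0.le, Real.rpow_natCast] at h3
  have hP : (0 : ℝ) < (1 + 4 * n : ℝ) ^ n := by positivity
  have hDs : 0 ≤ D ^ s := by positivity
  calc D ^ s = (1 + 4 * n : ℝ) ^ n * (((1 + 4 * n : ℝ) ^ n)⁻¹ * D ^ s) := by
        field_simp
    _ ≤ (1 + 4 * n : ℝ) ^ n * ((1 + 4 * n : ℝ) ^ s * D ^ s) := by gcongr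
    _ ≤ _ := by gcongr

/-- **Lemma 4.5**: for `n ≥ 2` there exists a constant `C_ddd` depending
only on `n` such that for every `p ∈ (1,∞)`, `ε ∈ (0,1/p)`, every `k ∈ ℤ`, every pair
of cubes `K₁,K₂` of side `2^{−k}` and their predecessors `K̃₁ ⊇ K₁`, `K̃₂ ⊇ K₂` of side
`2^{−k+1}`: if `dist(K̃₁,K̃₂) ≥ 2^{−k}`, then `ν(K̃₁×K̃₂) ≤ C_ddd ν(K₁×K₂)`. -/
theorem stmt_13 (n : ℕ) (hn : 2 ≤ n) :
    ∃ Cddd : ℝ, 0 < Cddd ∧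
      ∀ p : ℝ, 1 < p → ∀ ε : ℝ, 0 < ε → ε < 1 / p →
      ∀ (k : ℤ) (c₁ c₂ d₁ d₂ : EuclideanSpace ℝ (Fin n)),
        cube n c₁ ((2 : ℝ) ^ (-k)) ⊆ cube n d₁ ((2 : ℝ) ^ (-k + 1)) →
        cube n c₂ ((2 : ℝ) ^ (-k)) ⊆ cube n d₂ ((2 : ℝ) ^ (-k + 1)) →
        (2 : ℝ) ^ (-k) ≤
          setDistE (cube n d₁ ((2 : ℝ) ^ (-k + 1))) (cube n d₂ ((2 : ℝ) ^ (-k + 1))) →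
        nu n p ε (cube n d₁ ((2 : ℝ) ^ (-k + 1)) ×ˢ cube n d₂ ((2 : ℝ) ^ (-k + 1))) ≤
          ENNReal.ofReal Cddd *
            nu n p ε (cube n c₁ ((2 : ℝ) ^ (-k)) ×ˢ cube n c₂ ((2 : ℝ) ^ (-k))) := by
  refine ⟨4 ^ n * (1 + 4 * n) ^ n, by positivity, ?_⟩
  intro p hp ε hε hεp k c₁ c₂ d₁ d₂ h₁ h₂ hd
  have hl : (0 : ℝ) < 2 ^ (-k) := by positivity
  have h2l : (2 : ℝ) ^ (-k + 1) = 2 * 2 ^ (-k) := by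
    rw [zpow_add₀ two_ne_zero, zpow_one, mul_comm]
  rw [h2l] at h₁ h₂ hd ⊢
  clear h2l
  generalize (2 : ℝ) ^ (-k) = l at *
  have hp0 : 0 < p := by linarith
  have hεp1 : ε * p < 1 := by rwa [lt_div_iff₀ hp0] at hεp
  have hεp0 : 0 < ε * p := by positivity
  have hn' : (2 : ℝ) ≤ n := by exact_mod_cast hn
  have hsep : ∀ x ∈ cube n d₁ (2 * l), ∀ y ∈ cube n d₂ (2 * l), l ≤ ‖x - y‖ := by
    intro x hx y hy
    refine hd.trans ?_
    rw [← dist_eq_norm]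
    refine csInf_le ⟨0, ?_⟩ ⟨x, hx, y, hy, rfl⟩
    rintro _ ⟨a, _, b, _, rfl⟩
    exact dist_nonneg
  have hmd : MeasurableSet (cube n d₁ (2 * l) ×ˢ cube n d₂ (2 * l)) :=
    (measurableSet_cube _ _ _).prod (measurableSet_cube _ _ _)
  have hmc : MeasurableSet (cube n c₁ l ×ˢ cube n c₂ l) :=
    (measurableSet_cube _ _ _).prod (measurableSet_cube _ _ _)
  rw [nu, withDensity_apply _ hmd, withDensity_apply _ hmc]
  set f : EuclideanSpace ℝ (Fin n) × EuclideanSpace ℝ (Fin n) → ℝ≥0∞ :=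
    fun z => ENNReal.ofReal (‖z.1 - z.2‖ ^ (ε * p - n)) with hf
  set B : ℝ := (1 + 4 * n) ^ n with hB
  have key : ∀ z ∈ cube n d₁ (2 * l) ×ˢ cube n d₂ (2 * l),
      ∀ w ∈ cube n c₁ l ×ˢ cube n c₂ l, f z ≤ ENNReal.ofReal B * f w := by
    rintro ⟨x, y⟩ ⟨hx, hy⟩ ⟨u, v⟩ ⟨hu, hv⟩
    simp only [hf] at *
    rw [← ENNReal.ofReal_mul (by positivity)]
    apply ENNReal.ofReal_le_ofReal
    apply density_le n _ l hl (by linarith) (by linarith) _ _ (hsep x hx y hy)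
      (hsep u (h₁ hu) v (h₂ hv))
    have e1 := norm_sub_le_cube n d₁ u x (2 * l) (by linarith) (h₁ hu) hx
    have e2 := norm_sub_le_cube n d₂ y v (2 * l) (by linarith) hy (h₂ hv)
    have e3 : u - v = (x - y) + (u - x) + (y - v) := by abel
    rw [e3]
    have e4 := norm_add₃_le (a := x - y) (b := u - x) (c := y - v)
    linarith
  set M : ℝ≥0∞ := ⨆ z ∈ cube n d₁ (2 * l) ×ˢ cube n d₂ (2 * l), f z with hM
  have hvol : volume (cube n d₁ (2 * l) ×ˢ cube n d₂ (2 * l)) =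
      ENNReal.ofReal (4 ^ n) * volume (cube n c₁ l ×ˢ cube n c₂ l) := by
    rw [Measure.volume_eq_prod, Measure.prod_prod, Measure.prod_prod]
    simp only [volume_cube]
    rw [← ENNReal.ofReal_pow (by positivity), ← ENNReal.ofReal_pow (by positivity),
      ← ENNReal.ofReal_mul (by positivity), ← ENNReal.ofReal_mul (by positivity),
      ← ENNReal.ofReal_mul (by positivity)]
    congr 1
    rw [← mul_pow, ← mul_pow, ← mul_pow]
    congr 1
    ring
  calc ∫⁻ z in cube n d₁ (2 * l) ×ˢ cube n d₂ (2 * l), f z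
      ≤ ∫⁻ z in cube n d₁ (2 * l) ×ˢ cube n d₂ (2 * l), M :=
        setLIntegral_mono' hmd fun z hz => le_iSup₂_of_le z hz le_rfl
    _ = ENNReal.ofReal (4 ^ n) * ∫⁻ w in cube n c₁ l ×ˢ cube n c₂ l, M := by
        rw [setLIntegral_const, setLIntegral_const, hvol]
        ring
    _ ≤ ENNReal.ofReal (4 ^ n) * ∫⁻ w in cube n c₁ l ×ˢ cube n c₂ l, ENNReal.ofReal B * f w := by
        refine mul_le_mul_right ?_ _
        exact setLIntegral_mono' hmc fun w hw => iSup₂_le fun z hz => key z hz w hw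
    _ = _ := by
        rw [lintegral_const_mul' _ _ ENNReal.ofReal_ne_top, ← mul_assoc,
          ← ENNReal.ofReal_mul (by positivity)]

end
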